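/- The first homology of a knot complement is infinite cyclic: for any basepoint x₀ in (EuclideanSpace ℝ (Fin 3)) \ K, the abelianization of the fundamental group of (EuclideanSpace ℝ (Fin 3)) \ K at x₀ is isomorphic (as a group) to ℤ. (By the Hurewicz theorem this is the statement H₁(complement of K) ≅ ℤ from the homology computation of the knot complement.) -/

import Mathlib

section

open Filter Topology unitInterval

instance unitInterval.contractibleSpace : ContractibleSpace I :=
  (convex_Icc (0 : ℝ) 1).contractibleSpace ⟨0, by simp⟩

theorem exists_continuous_log {A : Type*} [TopologicalSpace A] [ContractibleSpace A]
    (f : C(A, ℂ)) (hf : ∀ a, f a ≠ 0) :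
    ∃ L : C(A, ℂ), ∀ a, Complex.exp (L a) = f a := by
  obtain ⟨a₀, ⟨H⟩⟩ := id_nullhomotopic A
  have hH : ∀ a, (⟨f (H.symm (0, a)), hf _⟩ : {z : ℂ // z ≠ 0}) =
      ⟨_, Complex.exp_ne_zero (Complex.log (f a₀))⟩ := by
    intro a
    refine Subtype.ext ?_
    simp [Complex.exp_log (hf a₀)]
  let G : C(I × A, {z : ℂ // z ≠ 0}) := ⟨fun x ↦ ⟨f (H.symm x), hf _⟩, by fun_prop⟩
  refine ⟨(Complex.isCoveringMap_exp.liftHomotopy G (.const A (Complex.log (f a₀))) hH).comp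
    ⟨fun a ↦ (1, a), by fun_prop⟩, fun a ↦ ?_⟩
  have := congrFun (Complex.isCoveringMap_exp.liftHomotopy_lifts G
    (.const A (Complex.log (f a₀))) hH) (1, a)
  simpa [G] using congrArg Subtype.val this

theorem sub_eq_sub_of_exp_eq {A : Type*} [TopologicalSpace A] [PreconnectedSpace A]
    (L L' : C(A, ℂ)) (h : ∀ a, Complex.exp (L a) = Complex.exp (L' a)) (a b : A) :
    L a - L b = L' a - L' b := by
  have key : (L : A → ℂ) = fun x ↦ L' x + (L b - L' b) := by
    refine Complex.isCoveringMap_exp.eq_of_comp_eq L.continuous (by fun_prop) ?_ b (by ring)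
    funext x
    refine Subtype.ext ?_
    simp [Complex.exp_add, Complex.exp_sub, h]
  have := congrFun key a
  rw [this]; ring

/-- The total variation of the logarithm along a path in `ℂ \ {0}`. -/
noncomputable def logVariation (p : I → ℂ) : ℂ :=
  open Classical in
  if h : ∃ L : C(I, ℂ), ∀ t, Complex.exp (L t) = p t then h.choose 1 - h.choose 0 else 0

theorem logVariation_eq {p : I → ℂ} (L : C(I, ℂ)) (h : ∀ t, Complex.exp (L t) = p t) :
    logVariation p = L 1 - L 0 := by
  have h' : ∃ L : C(I, ℂ), ∀ t, Complex.exp (L t) = p t := ⟨L, h⟩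
  rw [logVariation, dif_pos h']
  exact sub_eq_sub_of_exp_eq _ _ (fun t ↦ (h'.choose_spec t).trans (h t).symm) _ _

theorem logVariation_homotopy (H : C(I × I, ℂ)) (hH : ∀ x, H x ≠ 0)
    (h0 : ∀ s, H (s, 0) = H (0, 0)) (h1 : ∀ s, H (s, 1) = H (0, 1)) :
    logVariation (fun t ↦ H (0, t)) = logVariation (fun t ↦ H (1, t)) := by
  obtain ⟨L, hL⟩ := exists_continuous_log H hH
  have e0 : L (1, 0) - L (0, 0) = L (0, 0) - L (0, 0) :=
    sub_eq_sub_of_exp_eq (L.comp ⟨fun s ↦ (s, (0 : I)), by fun_prop⟩)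
      (.const I (L (0, 0))) (fun s ↦ by simp [hL, h0 s]) 1 0
  have e1 : L (1, 1) - L (0, 1) = L (0, 1) - L (0, 1) :=
    sub_eq_sub_of_exp_eq (L.comp ⟨fun s ↦ (s, (1 : I)), by fun_prop⟩)
      (.const I (L (0, 1))) (fun s ↦ by simp [hL, h1 s]) 1 0
  have d0 : logVariation (fun t ↦ H (0, t)) = L (0, 1) - L (0, 0) :=
    logVariation_eq (L.comp ⟨fun t ↦ ((0 : I), t), by fun_prop⟩) (fun t ↦ hL _)
  have d1 : logVariation (fun t ↦ H (1, t)) = L (1, 1) - L (1, 0) :=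
    logVariation_eq (L.comp ⟨fun t ↦ ((1 : I), t), by fun_prop⟩) (fun t ↦ hL _)
  rw [d0, d1]
  linear_combination e0 - e1

theorem logVariation_trans {X : Type*} [TopologicalSpace X] {B : X → ℂ} (hB : Continuous B)
    {x y z : X} (p : Path x y) (q : Path y z) (hp : ∀ t, B (p t) ≠ 0) (hq : ∀ t, B (q t) ≠ 0) :
    logVariation (fun t ↦ B (p.trans q t)) =
      logVariation (fun t ↦ B (p t)) + logVariation (fun t ↦ B (q t)) := by
  obtain ⟨L, hL⟩ := exists_continuous_log ⟨fun t ↦ B (p t), by fun_prop⟩ hp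
  obtain ⟨M, hM⟩ := exists_continuous_log ⟨fun t ↦ B (q t), by fun_prop⟩ hq
  simp only [ContinuousMap.coe_mk] at hL hM
  let P : Path (L 0) (L 1) := ⟨L, rfl, rfl⟩
  let Q : Path (L 1) (L 1 + (M 1 - M 0)) := ⟨M + .const I (L 1 - M 0), by simp, by simp; ring⟩
  have hQ : ∀ t, Complex.exp (Q t) = B (q t) := by
    intro t
    have : Complex.exp (L 1) = Complex.exp (M 0) := by rw [hL, hM]; simp
    simp [Q, Complex.exp_add, Complex.exp_sub, this, hM t]
  rw [logVariation_eq L hL, logVariation_eq M hM,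
    logVariation_eq (P.trans Q).toContinuousMap (p := fun t ↦ B (p.trans q t))]
  · simp only [Path.coe_toContinuousMap, Path.source, Path.target]
    ring
  · intro t
    simp only [Path.coe_toContinuousMap, Path.trans_apply]
    split_ifs
    · exact hL _
    · exact hQ _

/-- A homotopy invariant, additive function on paths. -/
structure PathCocycle (X A : Type*) [TopologicalSpace X] [AddCommGroup A] where
  val : ∀ {x y : X}, Path x y → A
  homotopic : ∀ {x y : X} {p q : Path x y}, p.Homotopic q → val p = val q
  trans : ∀ {x y z : X} (p : Path x y) (q : Path y z), val (p.trans q) = val p + val q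

namespace PathCocycle

variable {X A : Type*} [TopologicalSpace X] [AddCommGroup A] (c : PathCocycle X A)

theorem refl (x : X) : c.val (Path.refl x) = 0 := by
  have := c.trans (Path.refl x) (Path.refl x)
  rw [Path.refl_trans_refl] at this
  simpa using this

theorem symm {x y : X} (p : Path x y) : c.val p.symm = -c.val p := by
  have := c.trans p p.symm
  rw [← c.homotopic ⟨Path.Homotopy.reflTransSymm p⟩, c.refl] at this
  exact (neg_eq_of_add_eq_zero_right this.symm).symm

/-- The homomorphism on the fundamental group induced by a cocycle. -/
def hom (x : X) : FundamentalGroup X x →* Multiplicative A where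
  toFun g := Multiplicative.ofAdd (Quotient.lift (fun p ↦ c.val p) (fun _ _ h ↦ c.homotopic h) g)
  map_one' := by
    rw [FundamentalGroup.one_def]
    exact congrArg Multiplicative.ofAdd (c.refl x)
  map_mul' g h := by
    induction g using Path.Homotopic.Quotient.ind with | mk p =>
    induction h using Path.Homotopic.Quotient.ind with | mk q =>
    rw [FundamentalGroup.mul_def, mul_comm]
    exact congrArg Multiplicative.ofAdd (c.trans q p)

theorem hom_mk {x : X} (p : Path x x) :
    c.hom x (FundamentalGroup.fromPath (Path.Homotopic.Quotient.mk p)) =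
      Multiplicative.ofAdd (c.val p) := rfl

/-- The image of a cocycle under a homomorphism. -/
def map {A' : Type*} [AddCommGroup A'] (f : A →+ A') : PathCocycle X A' where
  val p := f (c.val p)
  homotopic h := by rw [c.homotopic h]
  trans p q := by rw [c.trans, map_add]

/-- The cocycle of germs of logarithmic variations along a sequence of functions that are
eventually non-vanishing on every compact set. -/
noncomputable def ofNonvanishing (B : ℕ → X → ℂ) (hB : ∀ n, Continuous (B n))
    (h : ∀ C : Set X, IsCompact C → ∀ᶠ n in atTop, ∀ x ∈ C, B n x ≠ 0) :
    PathCocycle X (Germ (atTop : Filter ℕ) ℂ) where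
  val p := ((fun n ↦ logVariation (fun t ↦ B n (p t)) : ℕ → ℂ) : Germ atTop ℂ)
  homotopic := by
    rintro x y p q ⟨H⟩
    refine Germ.coe_eq.2 ?_
    filter_upwards [h (Set.range H) (isCompact_range H.continuous)] with n hn
    have := logVariation_homotopy ⟨fun u ↦ B n (H u), (hB n).comp H.continuous⟩
      (fun u ↦ hn _ ⟨u, rfl⟩) (fun s ↦ by simp) (fun s ↦ by simp)
    simpa using this
  trans p q := by
    rw [← Germ.coe_add]
    refine Germ.coe_eq.2 ?_
    filter_upwards [h _ (isCompact_range p.continuous), h _ (isCompact_range q.continuous)]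
      with n hp hq
    exact logVariation_trans (hB n) p q (fun t ↦ hp _ ⟨t, rfl⟩) (fun t ↦ hq _ ⟨t, rfl⟩)

open CategoryTheory in
/-- The universal cocycle of a path connected space, with values in the abelianized
fundamental group. -/
theorem exists_universal [PathConnectedSpace X] (x₀ : X) :
    ∃ c : PathCocycle X (Additive (Abelianization (FundamentalGroup X x₀))),
      ∀ p : Path x₀ x₀, c.val p = Additive.ofMul (Abelianization.of
        (FundamentalGroup.fromPath (Path.Homotopic.Quotient.mk p))) := by
  let S : ∀ x : X, FundamentalGroupoid.mk x₀ ⟶ FundamentalGroupoid.mk x :=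
    fun x ↦ Path.Homotopic.Quotient.mk (PathConnectedSpace.somePath x₀ x)
  let T : ∀ {x y : X}, Path x y → (FundamentalGroupoid.mk x ⟶ FundamentalGroupoid.mk y) :=
    fun p ↦ Path.Homotopic.Quotient.mk p
  let loop : ∀ {x y : X}, Path x y → End (FundamentalGroupoid.mk x₀) :=
    fun {x y} p ↦ S x ≫ T p ≫ Groupoid.inv (S y)
  refine ⟨⟨fun p ↦ Additive.ofMul (Abelianization.of (loop p)), ?_, ?_⟩, ?_⟩
  · intro x y p q h
    have : T p = T q := Path.Homotopic.Quotient.eq.2 h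
    simp only [loop, this]
  · intro x y z p q
    rw [← ofMul_mul]
    have hT : T (p.trans q) = T p ≫ T q := rfl
    have : loop (p.trans q) = loop q * loop p := by
      simp only [loop, hT, End.mul_def, Category.assoc]
      rw [← Category.assoc (Groupoid.inv (S y)), Groupoid.inv_comp, Category.id_comp]
    rw [this, map_mul, mul_comm]
  · intro p
    let s : End (FundamentalGroupoid.mk x₀) := S x₀
    have : loop p = s⁻¹ * (FundamentalGroup.fromPath (Path.Homotopic.Quotient.mk p)) * s := by
      simp only [loop, End.mul_def]
      rfl
    change Additive.ofMul (Abelianization.of (loop p)) = _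
    rw [this]
    refine congrArg Additive.ofMul ?_
    rw [map_mul, map_mul, mul_right_comm, ← map_mul, inv_mul_cancel, map_one, one_mul]

/-- A cocycle becomes a coboundary on a simply connected space. -/
theorem exists_primitive {E : Type*} [TopologicalSpace E] [SimplyConnectedSpace E] (f : C(E, X)) :
    ∃ F : E → A, ∀ {x y : E} (p : Path x y), c.val (p.map f.continuous) = F y - F x := by
  obtain ⟨e⟩ : Nonempty E := inferInstance
  refine ⟨fun x ↦ c.val ((PathConnectedSpace.somePath e x).map f.continuous), ?_⟩
  intro x y p
  rw [eq_sub_iff_add_eq', ← c.trans, ← Path.map_trans]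
  exact c.homotopic ((SimplyConnectedSpace.paths_homotopic _ _).map f)

end PathCocycle

/-- The matrix `‖v‖ + v · σ`, where `σ` is the vector of Pauli matrices. -/
noncomputable def pauli (v : EuclideanSpace ℝ (Fin 3)) : Matrix (Fin 2) (Fin 2) ℂ :=
  !![(‖v‖ : ℂ) + v 2, v 0 - v 1 * Complex.I; v 0 + v 1 * Complex.I, (‖v‖ : ℂ) - v 2]

theorem continuous_pauli : Continuous pauli := by
  refine continuous_matrix fun i j ↦ ?_
  fin_cases i <;> fin_cases j <;> simp [pauli] <;> fun_prop

theorem norm_sq_eq_coord (v : EuclideanSpace ℝ (Fin 3)) :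
    (‖v‖ : ℂ) ^ 2 = (v 0 : ℂ) ^ 2 + (v 1 : ℂ) ^ 2 + (v 2 : ℂ) ^ 2 := by
  have := EuclideanSpace.real_norm_sq_eq v
  rw [Fin.sum_univ_three] at this
  exact_mod_cast this

theorem pauli_det (v : EuclideanSpace ℝ (Fin 3)) :
    pauli v 0 0 * pauli v 1 1 = pauli v 0 1 * pauli v 1 0 := by
  simp only [pauli, Matrix.of_apply, Matrix.cons_val', Matrix.cons_val_zero, Matrix.cons_val_one,
    Matrix.cons_val_fin_one]
  linear_combination norm_sq_eq_coord v + (v 1 : ℂ) ^ 2 * Complex.I_sq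

theorem mul_mul_eq_trace_smul {Q : Matrix (Fin 2) (Fin 2) ℂ}
    (hQ : Q 0 0 * Q 1 1 = Q 0 1 * Q 1 0) (M : Matrix (Fin 2) (Fin 2) ℂ) :
    Q * M * Q = (Q * M).trace • Q := by
  ext i j
  fin_cases i <;> fin_cases j <;>
  simp [Matrix.mul_apply, Matrix.trace_fin_two, Fin.sum_univ_two]
  · linear_combination -M 1 1 * hQ
  · linear_combination M 0 1 * hQ
  · linear_combination M 1 0 * hQ
  · linear_combination -M 0 0 * hQ

theorem pauli_mul_pauli_mul_pauli (v w : EuclideanSpace ℝ (Fin 3)) :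
    pauli v * pauli w * pauli v = ((2 * (‖v‖ * ‖w‖ + inner ℝ v w) : ℝ) : ℂ) • pauli v := by
  rw [mul_mul_eq_trace_smul (pauli_det v)]
  congr 1
  simp [pauli, Matrix.trace_fin_two, PiLp.inner_apply, Fin.sum_univ_three]
  linear_combination (-2 * (v 1 : ℂ) * w 1) * Complex.I_sq

theorem norm_mul_norm_add_inner_ne_zero {V : Type*} [NormedAddCommGroup V] [InnerProductSpace ℝ V]
    {v w : V} (h : (0 : V) ∉ segment ℝ v w) : ‖v‖ * ‖w‖ + inner ℝ v w ≠ 0 := by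
  intro h0
  apply h
  have : inner ℝ v (-w) = ‖v‖ * ‖-w‖ := by rw [inner_neg_right, norm_neg]; linarith
  have := (inner_eq_norm_mul_iff_real.1 this)
  rw [norm_neg, smul_neg] at this
  rw [mem_segment_iff_sameRay, zero_sub, sub_zero, sameRay_iff_norm_smul_eq, norm_neg, smul_neg,
    this, neg_neg]

/-- The product of the matrices `pauli (w i)` for `i ≤ m`. -/
noncomputable def pauliChain (w : ℕ → EuclideanSpace ℝ (Fin 3)) : ℕ → Matrix (Fin 2) (Fin 2) ℂ
  | 0 => pauli (w 0)
  | m + 1 => pauliChain w m * pauli (w (m + 1))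

theorem pauliChain_eq_mul (w : ℕ → EuclideanSpace ℝ (Fin 3)) (m : ℕ) :
    ∃ R, pauliChain w m = pauli (w 0) * R := by
  induction m with
  | zero => exact ⟨1, by simp [pauliChain]⟩
  | succ m ih =>
    obtain ⟨R, hR⟩ := ih
    exact ⟨R * pauli (w (m + 1)), by rw [pauliChain, hR, Matrix.mul_assoc]⟩

theorem pauliChain_eq_mul' (w : ℕ → EuclideanSpace ℝ (Fin 3)) (m : ℕ) :
    ∃ R, pauliChain w m = R * pauli (w m) := by
  cases m with
  | zero => exact ⟨1, by simp [pauliChain]⟩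
  | succ m => exact ⟨_, rfl⟩

theorem pauli_mul_pauli_mul_ne_zero {v w : EuclideanSpace ℝ (Fin 3)}
    (h : (0 : EuclideanSpace ℝ (Fin 3)) ∉ segment ℝ v w) {M : Matrix (Fin 2) (Fin 2) ℂ}
    (hM : pauli w * M ≠ 0) : pauli v * (pauli w * M) ≠ 0 := by
  intro h0
  have h1 : pauli w * pauli v * pauli w * M = 0 := by
    rw [Matrix.mul_assoc, Matrix.mul_assoc, h0, Matrix.mul_zero]
  rw [pauli_mul_pauli_mul_pauli, Matrix.smul_mul, smul_eq_zero, or_iff_left hM] at h1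
  have h2 := norm_mul_norm_add_inner_ne_zero h
  rw [Complex.ofReal_eq_zero, mul_comm ‖w‖, real_inner_comm] at h1
  simp_all

theorem pauliChain_mul_ne_zero (w : ℕ → EuclideanSpace ℝ (Fin 3)) (m : ℕ)
    (h : ∀ i < m, (0 : EuclideanSpace ℝ (Fin 3)) ∉ segment ℝ (w i) (w (i + 1)))
    {M : Matrix (Fin 2) (Fin 2) ℂ} (hM : pauli (w m) * M ≠ 0) : pauliChain w m * M ≠ 0 := by
  induction m generalizing M with
  | zero => exact hM
  | succ m ih =>
    rw [pauliChain, Matrix.mul_assoc]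
    exact ih (fun i hi ↦ h i (by omega)) (pauli_mul_pauli_mul_ne_zero (h m (by omega)) hM)

theorem pauli_ne_zero {v : EuclideanSpace ℝ (Fin 3)} (h : v ≠ 0) : pauli v ≠ 0 := by
  intro h0
  have h1 := congrFun (congrFun h0 0) 0
  have h2 := congrFun (congrFun h0 1) 1
  simp [pauli] at h1 h2
  have : (‖v‖ : ℂ) = 0 := by linear_combination (h1 + h2) / 2
  exact h (by simpa using this)

/-- A function on Euclidean space, vanishing exactly on the closed polygon with vertices
`P 0, …, P m`. Its argument is half the solid angle of the polygon. -/
noncomputable def polygonFun (P : ℕ → EuclideanSpace ℝ (Fin 3)) (m : ℕ)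
    (x : EuclideanSpace ℝ (Fin 3)) : ℂ :=
  (pauliChain (fun i ↦ P i - x) m).trace

theorem continuous_pauliChain (P : ℕ → EuclideanSpace ℝ (Fin 3)) (m : ℕ) :
    Continuous fun x ↦ pauliChain (fun i ↦ P i - x) m := by
  induction m with
  | zero => exact continuous_pauli.comp (by fun_prop)
  | succ m ih => exact ih.matrix_mul (continuous_pauli.comp (by fun_prop))

theorem continuous_polygonFun (P : ℕ → EuclideanSpace ℝ (Fin 3)) (m : ℕ) :
    Continuous (polygonFun P m) :=
  (continuous_pauliChain P m).matrix_trace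

theorem zero_mem_segment_sub {V : Type*} [AddCommGroup V] [Module ℝ V] {a b x : V} :
    (0 : V) ∈ segment ℝ (a - x) (b - x) ↔ x ∈ segment ℝ a b := by
  rw [← mem_segment_translate ℝ x]
  simp

theorem polygonFun_ne_zero {P : ℕ → EuclideanSpace ℝ (Fin 3)} {m : ℕ}
    {x : EuclideanSpace ℝ (Fin 3)} (h : ∀ i < m, x ∉ segment ℝ (P i) (P (i + 1)))
    (h' : x ∉ segment ℝ (P m) (P 0)) : polygonFun P m x ≠ 0 := by
  simp only [← zero_mem_segment_sub (x := x)] at h h'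
  have h0 : pauli (P 0 - x) * 1 ≠ 0 := by
    rw [Matrix.mul_one]
    exact pauli_ne_zero fun e ↦ h' (e ▸ right_mem_segment ℝ _ _)
  have hne := pauliChain_mul_ne_zero (fun i ↦ P i - x) m h (pauli_mul_pauli_mul_ne_zero h' h0)
  rw [Matrix.mul_one] at hne
  obtain ⟨R, hR⟩ := pauliChain_eq_mul (fun i ↦ P i - x) m
  intro htr
  rw [polygonFun, hR] at htr
  rw [hR, mul_mul_eq_trace_smul (pauli_det _), htr, zero_smul] at hne
  exact hne rfl

theorem mul_apply_left {Q : Matrix (Fin 2) (Fin 2) ℂ}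
    (hQ : Q 0 0 * Q 1 1 = Q 0 1 * Q 1 0) (M : Matrix (Fin 2) (Fin 2) ℂ) (i j : Fin 2) :
    Q 0 0 * (Q * M) i j = Q i 0 * (Q * M) 0 j := by
  fin_cases i <;> simp [Matrix.mul_apply, Fin.sum_univ_two]
  linear_combination M 1 j * hQ

theorem mul_apply_right {Q : Matrix (Fin 2) (Fin 2) ℂ}
    (hQ : Q 0 0 * Q 1 1 = Q 0 1 * Q 1 0) (M : Matrix (Fin 2) (Fin 2) ℂ) (i j : Fin 2) :
    (M * Q) i j * Q 1 1 = (M * Q) i 1 * Q 1 j := by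
  fin_cases j <;> simp [Matrix.mul_apply, Fin.sum_univ_two]
  linear_combination M i 0 * hQ

theorem pauliChain_apply (w : ℕ → EuclideanSpace ℝ (Fin 3)) (m : ℕ) (i j : Fin 2) :
    pauli (w 0) 0 0 * pauliChain w m i j * pauli (w m) 1 1 =
      pauli (w 0) i 0 * pauliChain w m 0 1 * pauli (w m) 1 j := by
  have h1 : ∀ j, pauli (w 0) 0 0 * pauliChain w m i j = pauli (w 0) i 0 * pauliChain w m 0 j := by
    intro j
    obtain ⟨R, hR⟩ := pauliChain_eq_mul w m
    rw [hR]; exact mul_apply_left (pauli_det _) R i j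
  have h2 : pauliChain w m 0 j * pauli (w m) 1 1 = pauliChain w m 0 1 * pauli (w m) 1 j := by
    obtain ⟨R, hR⟩ := pauliChain_eq_mul' w m
    rw [hR]; exact mul_apply_right (pauli_det _) R 0 j
  rw [h1, mul_assoc, h2, mul_assoc]

theorem logVariation_loop {p : I → ℂ} (LH k : C(I, ℂ)) (hL : LH 0 = LH 1) (hk : k 0 = k 1)
    (hs : ∀ s, k s ∈ Complex.slitPlane)
    (hp : ∀ s : I, p s = -(Complex.exp (2 * Real.pi * Complex.I * (s : ℝ)) *
      Complex.exp (LH s) * k s)) : logVariation p = 2 * Real.pi * Complex.I := by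
  have hc : Continuous fun s : I ↦ 2 * Real.pi * Complex.I * (s : ℝ) + LH s + Complex.log (k s) +
      Real.pi * Complex.I :=
    ((Continuous.add (by fun_prop) LH.continuous).add (k.continuous.clog hs)).add continuous_const
  rw [logVariation_eq ⟨_, hc⟩]
  · simp [hL, hk]
  · intro s
    simp only [ContinuousMap.coe_mk, Complex.exp_add, Complex.exp_pi_mul_I,
      Complex.exp_log (Complex.slitPlane_ne_zero (hs s)), hp]
    ring

/-- The parametrization of a horizontal disc around the origin. -/
noncomputable def horizontal (ρ : ℝ) (z : ℂ) : EuclideanSpace ℝ (Fin 3) := !₂[ρ * z.re, ρ * z.im, 0]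

theorem continuous_horizontal (ρ : ℝ) : Continuous (horizontal ρ) := by
  unfold horizontal; fun_prop

theorem logVariation_polygonFun {P : ℕ → EuclideanSpace ℝ (Fin 3)} {m : ℕ} {ρ : ℝ}
    (h : ∀ z : ℂ, ‖z‖ ≤ 1 → ∀ i < m, horizontal ρ z ∉ segment ℝ (P i) (P (i + 1)))
    (h0 : 0 < P 0 2) (hm : P m 2 < 0) (h0' : ‖(P 0 0 + P 0 1 * Complex.I : ℂ)‖ < ρ)
    (hm' : ‖(P m 0 + P m 1 * Complex.I : ℂ)‖ < ρ) :
    logVariation (fun s : I ↦ polygonFun P m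
      (horizontal ρ (Complex.exp (2 * Real.pi * Complex.I * (s : ℝ))))) =
      2 * Real.pi * Complex.I := by
  have hA : ∀ z, 0 < ‖P 0 - horizontal ρ z‖ + P 0 2 := fun z ↦ by positivity
  have hB : ∀ z, 0 < ‖P m - horizontal ρ z‖ - P m 2 := fun z ↦ by
    have := norm_nonneg (P m - horizontal ρ z); linarith
  have hQa : ∀ z, pauli (P 0 - horizontal ρ z) 0 0 =
      ((‖P 0 - horizontal ρ z‖ + P 0 2 : ℝ) : ℂ) := by
    intro z; simp [pauli, horizontal]
  have hQb : ∀ z, pauli (P m - horizontal ρ z) 1 1 =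
      ((‖P m - horizontal ρ z‖ - P m 2 : ℝ) : ℂ) := by
    intro z; simp [pauli, horizontal]
  have hQa' : ∀ z, pauli (P 0 - horizontal ρ z) 1 0 = (P 0 0 + P 0 1 * Complex.I) - ρ * z := by
    intro z
    simp [pauli, horizontal]
    linear_combination (-(ρ : ℂ)) * Complex.re_add_im z
  have hQb' : ∀ z, pauli (P m - horizontal ρ z) 1 0 = (P m 0 + P m 1 * Complex.I) - ρ * z := by
    intro z
    simp [pauli, horizontal]
    linear_combination (-(ρ : ℂ)) * Complex.re_add_im z
  generalize (P 0 0 + P 0 1 * Complex.I : ℂ) = α at *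
  generalize (P m 0 + P m 1 * Complex.I : ℂ) = β at *
  set a : ℂ → ℝ := fun z ↦ ‖P 0 - horizontal ρ z‖ + P 0 2 with ha
  set b : ℂ → ℝ := fun z ↦ ‖P m - horizontal ρ z‖ - P m 2 with hb
  have ca : Continuous a := by have := continuous_horizontal ρ; fun_prop
  have cb : Continuous b := by have := continuous_horizontal ρ; fun_prop
  have hC : ∀ z : ℂ, ‖z‖ ≤ 1 → pauliChain (fun i ↦ P i - horizontal ρ z) m 0 1 ≠ 0 := by
    intro z hz hC
    have hne := pauliChain_mul_ne_zero (fun i ↦ P i - horizontal ρ z) m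
      (fun i hi ↦ by simpa only [zero_mem_segment_sub] using h z hz i hi) (M := 1)
      (by
        rw [Matrix.mul_one]
        intro h0
        have := congrFun (congrFun h0 1) 1
        rw [hQb, Matrix.zero_apply] at this
        exact (hB z).ne' (by exact_mod_cast this))
    apply hne
    rw [Matrix.mul_one]
    ext i j
    have := pauliChain_apply (fun i ↦ P i - horizontal ρ z) m i j
    simp only [hC, hQa, hQb] at this
    have h1 := (hA z).ne'
    have h2 := (hB z).ne'
    simp only [mul_zero, zero_mul, mul_eq_zero, Complex.ofReal_eq_zero] at this
    tauto
  obtain ⟨L, hL⟩ : ∃ L : C(Metric.closedBall (0 : ℂ) 1, ℂ), ∀ z,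
      Complex.exp (L z) = pauliChain (fun i ↦ P i - horizontal ρ z) m 0 1 := by
    have := (convex_closedBall (0 : ℂ) 1).contractibleSpace ⟨0, by simp⟩
    refine exists_continuous_log ⟨fun z : Metric.closedBall (0 : ℂ) 1 ↦
      pauliChain (fun i ↦ P i - horizontal ρ z) m 0 1, ?_⟩ fun z ↦ hC z (mem_closedBall_zero_iff.1 z.2)
    exact ((continuous_pauliChain P m).comp
      ((continuous_horizontal ρ).comp continuous_subtype_val)).matrix_elem 0 1
  have hu : ∀ s : ℝ, ‖Complex.exp (2 * Real.pi * Complex.I * s)‖ = 1 := fun s ↦ by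
    rw [show (2 * Real.pi * Complex.I * s : ℂ) = ((2 * Real.pi * s : ℝ) : ℂ) * Complex.I by
      push_cast; ring]
    exact Complex.norm_exp_ofReal_mul_I _
  let u : C(I, ℂ) := ⟨fun s ↦ Complex.exp (2 * Real.pi * Complex.I * (s : ℝ)), by fun_prop⟩
  have hu01 : u 0 = u 1 := by simp [u]
  have hu1 : ∀ s, ‖u s‖ = 1 := fun s ↦ hu s
  have hu0 : ∀ s, u s ≠ 0 := fun s ↦ Complex.exp_ne_zero _
  let D : C(I, Metric.closedBall (0 : ℂ) 1) := ⟨fun s ↦ ⟨u s, by simp [hu1]⟩, by fun_prop⟩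
  let k : C(I, ℂ) := ⟨fun s ↦ ((ρ * (a (u s) + b (u s)) : ℝ) -
    (u s)⁻¹ * (a (u s) * β + b (u s) * α)) / (a (u s) * b (u s) : ℝ), by
      refine Continuous.div (by fun_prop (disch := exact hu0 _)) (by fun_prop) fun s ↦ ?_
      exact_mod_cast (mul_pos (hA _) (hB _)).ne'⟩
  refine logVariation_loop (L.comp D) k ?_ ?_ ?_ ?_
  · have : D 0 = D 1 := Subtype.ext hu01
    simp [this]
  · simp only [k, ContinuousMap.coe_mk, hu01]
  · intro s
    have pa := hA (u s)
    have pb := hB (u s)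
    refine Or.inl ?_
    have hre : ((u s)⁻¹ * (a (u s) * β + b (u s) * α)).re < ρ * (a (u s) + b (u s)) := by
      refine (Complex.re_le_norm _).trans_lt ?_
      rw [norm_mul, norm_inv, hu1, inv_one, one_mul]
      refine (norm_add_le _ _).trans_lt ?_
      rw [norm_mul, norm_mul, Complex.norm_of_nonneg pa.le, Complex.norm_of_nonneg pb.le]
      nlinarith
    simp only [k, ContinuousMap.coe_mk]
    rw [Complex.div_ofReal_re, Complex.sub_re, Complex.ofReal_re]
    exact div_pos (sub_pos.2 hre) (mul_pos pa pb)
  · intro s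
    simp only [ContinuousMap.comp_apply, hL]
    have hz := pauliChain_apply (fun i ↦ P i - horizontal ρ (u s)) m
    have h0 := hz 0 0
    have h1 := hz 1 1
    have pa := (hA (u s)).ne'
    have pb := (hB (u s)).ne'
    simp only [hQa, hQb, hQa', hQb'] at h0 h1
    change polygonFun P m (horizontal ρ (u s)) =
      -(u s * pauliChain (fun i ↦ P i - horizontal ρ (u s)) m 0 1 * k s)
    rw [polygonFun, Matrix.trace_fin_two]
    simp only [k, ContinuousMap.coe_mk]
    have pab : ((a (u s) * b (u s) : ℝ) : ℂ) ≠ 0 := by exact_mod_cast mul_ne_zero pa pb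
    rw [← mul_right_inj' pab, mul_neg, mul_left_comm, mul_div_cancel₀ _ pab]
    have huu := mul_inv_cancel₀ (hu0 s)
    push_cast
    linear_combination h0 + h1 -
      (pauliChain (fun i ↦ P i - horizontal ρ (u s)) m 0 1 * (a (u s) * β + b (u s) * α)) * huu

namespace PathCocycle

variable {X A : Type*} [TopologicalSpace X] [AddCommGroup A] (c : PathCocycle X A)

theorem val_cast {x y x' y' : X} (p : Path x y) (hx : x' = x) (hy : y' = y) :
    c.val (p.cast hx hy) = c.val p := by
  subst hx hy; rfl

theorem exists_primitive_path {x y : X} (p : Path x y) :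
    ∃ g : I → A, (∀ s t, c.val (p.subpath s t) = g t - g s) ∧ c.val p = g 1 - g 0 := by
  obtain ⟨g, hg⟩ := c.exists_primitive p.toContinuousMap
  have h : ∀ s t, c.val (p.subpath s t) = g t - g s := fun s t ↦
    hg ⟨⟨Set.Icc.convexComb s t, by fun_prop⟩, by simp, by simp⟩
  refine ⟨g, h, ?_⟩
  rw [← h, Path.subpath_zero_one, val_cast]

theorem exists_primitive_of_loops {S : Set X} (hS : ∀ x ∈ S, ∀ y ∈ S, JoinedIn S x y)
    (h : ∀ (x : X) (p : Path x x), (∀ t, p t ∈ S) → c.val p = 0) :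
    ∃ F : X → A, ∀ (x y : X) (p : Path x y), (∀ t, p t ∈ S) → c.val p = F y - F x := by
  by_cases hne : S.Nonempty
  · obtain ⟨e, he⟩ := hne
    classical
    refine ⟨fun x ↦ if hx : x ∈ S then c.val (hS e he x hx).somePath else 0, fun x y p hp ↦ ?_⟩
    have hx : x ∈ S := by simpa using hp 0
    have hy : y ∈ S := by simpa using hp 1
    simp only [dif_pos hx, dif_pos hy]
    have := h e (((hS e he x hx).somePath.trans p).trans (hS e he y hy).somePath.symm) fun t ↦ by
      rw [Path.trans_apply]
      split_ifs
      · rw [Path.trans_apply]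
        split_ifs
        · exact JoinedIn.somePath_mem _ _
        · exact hp _
      · exact JoinedIn.somePath_mem _ _
    rw [c.trans, c.trans, c.symm] at this
    rw [← sub_eq_zero, ← this]
    abel
  · exact ⟨0, fun x y p hp ↦ (hne ⟨_, hp 0⟩).elim⟩

end PathCocycle

theorem sum_range_eq_of_grid {X A : Type*} [AddCommGroup A] (d : X → X → A) (γ : ℕ → ℕ → X)
    (n : ℕ) (hγ : ∀ j, γ j n = γ j 0)
    (h : ∀ j < n, ∀ i < n, d (γ j i) (γ j (i + 1)) + d (γ j (i + 1)) (γ (j + 1) (i + 1)) =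
      d (γ j i) (γ (j + 1) i) + d (γ (j + 1) i) (γ (j + 1) (i + 1))) :
    ∑ i ∈ Finset.range n, d (γ 0 i) (γ 0 (i + 1)) =
      ∑ i ∈ Finset.range n, d (γ n i) (γ n (i + 1)) := by
  suffices ∀ j ≤ n, ∑ i ∈ Finset.range n, d (γ 0 i) (γ 0 (i + 1)) =
      ∑ i ∈ Finset.range n, d (γ j i) (γ j (i + 1)) from this n le_rfl
  intro j
  induction j with
  | zero => intro _; rfl
  | succ j ih =>
    intro hj
    rw [ih (by omega), ← sub_eq_zero, ← Finset.sum_sub_distrib,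
      Finset.sum_congr rfl (g := fun i ↦ d (γ j i) (γ (j + 1) i) -
        d (γ j (i + 1)) (γ (j + 1) (i + 1))), Finset.sum_range_sub', hγ, hγ, sub_self]
    intro i hi
    have := h j (by omega) i (Finset.mem_range.1 hi)
    rw [sub_eq_sub_iff_add_eq_add, this, add_comm]

/-- A cocycle on a dense subset of a normed space, meeting each ball in a path connected set,
vanishes on all loops if it vanishes on sufficiently small loops. -/
theorem PathCocycle.eq_zero_of_locally {V A : Type*} [NormedAddCommGroup V] [NormedSpace ℝ V]
    [AddCommGroup A] {X : Set V} (hX : Dense X)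
    (hJ : ∀ (v : V) (δ : ℝ) (x y : X), (x : V) ∈ Metric.ball v δ → (y : V) ∈ Metric.ball v δ →
      JoinedIn {z : X | (z : V) ∈ Metric.ball v δ} x y)
    (c : PathCocycle X A)
    (hloc : ∀ v : V, ∃ δ > 0, ∀ (x : X) (p : Path x x),
      (∀ t, (p t : V) ∈ Metric.ball v δ) → c.val p = 0)
    (x : X) (p : Path x x) : c.val p = 0 := by
  choose δ' hδ' hloc using hloc
  let H : I × I → V := fun u ↦ (1 - (u.1 : ℝ)) • (p u.2 : V) + (u.1 : ℝ) • (x : V)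
  have hH : Continuous H := by fun_prop
  obtain ⟨δ, hδ, hleb⟩ := lebesgue_number_lemma_of_metric (isCompact_range hH)
    (c := fun v ↦ Metric.ball v (δ' v)) (fun v ↦ Metric.isOpen_ball)
    (fun v _ ↦ Set.mem_iUnion.2 ⟨v, Metric.mem_ball_self (hδ' v)⟩)
  have hF : ∀ u : I × I, ∃ F : X → A, ∀ (x y : X) (q : Path x y),
      (∀ t, (q t : V) ∈ Metric.ball (H u) δ) → c.val q = F y - F x := by
    intro u
    obtain ⟨v, hv⟩ := hleb _ ⟨u, rfl⟩
    exact c.exists_primitive_of_loops (fun x hx y hy ↦ hJ _ _ x y hx hy)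
      fun x q hq ↦ hloc v x q fun t ↦ hv (hq t)
  choose F hF using hF
  classical
  let d : X → X → A := fun y z ↦ if h : (z : V) ∈ Metric.ball (y : V) (δ / 2) then
    c.val (hJ y (δ / 2) y z (Metric.mem_ball_self (half_pos hδ)) h).somePath else 0
  have hd : ∀ (u : I × I) (y z : X), dist (y : V) (H u) ≤ δ / 2 → dist (z : V) y < δ / 2 →
      d y z = F u z - F u y := by
    intro u y z hy hz
    simp only [d]
    rw [dif_pos (show (z : V) ∈ Metric.ball (y : V) (δ / 2) from hz)]
    refine hF u _ _ _ fun t ↦ ?_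
    have := JoinedIn.somePath_mem (hJ y (δ / 2) y z (Metric.mem_ball_self (half_pos hδ)) hz) t
    have := dist_triangle (((hJ y (δ / 2) y z (Metric.mem_ball_self
      (half_pos hδ)) hz).somePath t : X) : V) y (H u)
    simp only [Set.mem_ofPred_eq, Metric.mem_ball] at *
    linarith
  obtain ⟨η, hη, hunif⟩ := Metric.uniformContinuous_iff.1
    (CompactSpace.uniformContinuous_of_continuous hH) (δ / 8) (by positivity)
  obtain ⟨n, hn⟩ := exists_nat_gt (1 / η)
  have hn0 : (0 : ℝ) < n := lt_trans (by positivity) hn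
  have hnη : 1 / (n : ℝ) < η := by rwa [one_div_lt hn0 hη]
  let τ : ℕ → I := fun i ↦ Set.projIcc 0 1 zero_le_one ((i : ℝ) / n)
  have hτ0 : τ 0 = 0 := by simp [τ]
  have hτn : τ n = 1 := by simp [τ, hn0.ne']
  have hτ : ∀ i, dist (τ (i + 1)) (τ i) < η := by
    intro i
    refine lt_of_le_of_lt ?_ hnη
    have := Set.abs_projIcc_sub_projIcc (a := (0 : ℝ)) (b := 1) (c := ((i + 1 : ℕ) : ℝ) / n)
      (d := (i : ℝ) / n) zero_le_one
    refine this.trans ?_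
    rw [← sub_div, abs_of_nonneg (by simp)]
    simp
  have hτm : ∀ i, τ i ≤ τ (i + 1) := by
    intro i
    refine Set.monotone_projIcc _ ?_
    gcongr; simp
  have happ : ∀ v : V, ∃ y : X, dist (y : V) v < δ / 8 ∧ (∀ h : v ∈ X, y = ⟨v, h⟩) := by
    intro v
    by_cases hv : v ∈ X
    · exact ⟨⟨v, hv⟩, by simpa using hδ, fun _ ↦ rfl⟩
    · obtain ⟨y, hy, hy'⟩ := hX.exists_dist_lt v (show 0 < δ / 8 by positivity)
      exact ⟨⟨y, hy⟩, by rwa [dist_comm], fun h ↦ (hv h).elim⟩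
  choose π hπ hπ' using happ
  have hπx : ∀ y : X, π y = y := fun y ↦ hπ' y y.2
  let γ : ℕ → ℕ → X := fun j i ↦ π (H (τ j, τ i))
  have hγ0 : ∀ i, γ 0 i = p (τ i) := by intro i; simp [γ, H, hτ0, hπx]
  have hγn : ∀ i, γ n i = x := by intro i; simp [γ, H, hτn, hπx]
  have hγl : ∀ j, γ j 0 = x := by
    intro j
    have : H (τ j, τ 0) = x := by simp [H, hτ0, sub_smul]
    simp [γ, this, hπx]
  have hγr : ∀ j, γ j n = x := by
    intro j
    have : H (τ j, τ n) = x := by simp [H, hτn, sub_smul]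
    simp [γ, this, hπx]
  have hH1 : ∀ j i, dist (H (τ j, τ (i + 1))) (H (τ j, τ i)) < δ / 8 := fun j i ↦
    hunif (by simpa [Prod.dist_eq, hη] using hτ i)
  have hH2 : ∀ j i, dist (H (τ (j + 1), τ i)) (H (τ j, τ i)) < δ / 8 := fun j i ↦
    hunif (by simpa [Prod.dist_eq, hη] using hτ j)
  have hγ : ∀ j i, dist (γ j i : V) (H (τ j, τ i)) < δ / 8 := fun j i ↦ hπ _
  have hγ1 : ∀ j i, dist (γ j (i + 1) : V) (γ j i) < δ / 2 := by
    intro j i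
    have := dist_triangle4_right (γ j (i + 1) : V) (γ j i) (H (τ j, τ (i + 1))) (H (τ j, τ i))
    linarith [hγ j i, hγ j (i + 1), hH1 j i]
  have hγ2 : ∀ j i, dist (γ (j + 1) i : V) (γ j i) < δ / 2 := by
    intro j i
    have := dist_triangle4_right (γ (j + 1) i : V) (γ j i) (H (τ (j + 1), τ i)) (H (τ j, τ i))
    linarith [hγ j i, hγ (j + 1) i, hH2 j i]
  have hγ1' : ∀ j i, dist (γ j (i + 1) : V) (H (τ j, τ i)) ≤ δ / 2 := by
    intro j i
    have := dist_triangle (γ j (i + 1) : V) (H (τ j, τ (i + 1))) (H (τ j, τ i))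
    linarith [hγ j (i + 1), hH1 j i]
  have hγ2' : ∀ j i, dist (γ (j + 1) i : V) (H (τ j, τ i)) ≤ δ / 2 := by
    intro j i
    have := dist_triangle (γ (j + 1) i : V) (H (τ (j + 1), τ i)) (H (τ j, τ i))
    linarith [hγ (j + 1) i, hH2 j i]
  have hγ' : ∀ j i, dist (γ j i : V) (H (τ j, τ i)) ≤ δ / 2 := by
    intro j i; linarith [hγ j i]
  have key := sum_range_eq_of_grid d γ n (fun j ↦ by rw [hγl, hγr]) (by
    intro j _ i _
    rw [hd (τ j, τ i) _ _ (hγ' j i) (hγ1 j i), hd (τ j, τ i) _ _ (hγ1' j i) (hγ2 j (i + 1)),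
      hd (τ j, τ i) _ _ (hγ' j i) (hγ2 j i), hd (τ j, τ i) _ _ (hγ2' j i) (hγ1 (j + 1) i)]
    abel)
  obtain ⟨g, hg, hgp⟩ := c.exists_primitive_path p
  rw [hgp, ← hτ0, ← hτn, ← Finset.sum_range_sub (fun i ↦ g (τ i)),
    ← Finset.sum_congr rfl (f := fun i ↦ d (γ 0 i) (γ 0 (i + 1))), key]
  · refine Finset.sum_eq_zero fun i _ ↦ ?_
    rw [hd (τ n, τ i) _ _ (hγ' n i) (hγ1 n i), hγn, hγn, sub_self]
  · intro i _
    rw [hd (τ 0, τ i) _ _ (hγ' 0 i) (hγ1 0 i), hγ0, hγ0, ← hg]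
    symm
    refine hF _ _ _ _ fun t ↦ ?_
    have : (p.subpath (τ i) (τ (i + 1))) t ∈ p '' Set.Icc (τ i) (τ (i + 1)) := by
      rw [← Path.range_subpath_of_le _ _ _ (hτm i)]
      exact ⟨t, rfl⟩
    obtain ⟨s, hs, hst⟩ := this
    rw [← hst]
    have e : (p s : V) = H (τ 0, s) := by simp [H, hτ0]
    rw [e]
    refine (hunif ?_).trans (by linarith)
    have : dist s (τ i) ≤ dist (τ (i + 1)) (τ i) := by
      have h1 : (τ i : ℝ) ≤ s := hs.1
      have h2 : (s : ℝ) ≤ τ (i + 1) := hs.2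
      rw [Subtype.dist_eq, Subtype.dist_eq, Real.dist_eq, Real.dist_eq,
        abs_of_nonneg (by linarith), abs_of_nonneg (by linarith)]
      linarith
    simpa [Prod.dist_eq, hη] using this.trans_lt (hτ i)

section GeneralPosition

variable {V : Type*} [NormedAddCommGroup V] [NormedSpace ℝ V] [FiniteDimensional ℝ V]

theorem dense_compl_cone {r : ℝ → V} (hr : ContDiff ℝ 1 r) (hV : 2 < Module.finrank ℝ V) (x : V) :
    Dense (Set.range fun u : ℝ × ℝ ↦ x + u.1 • (r u.2 - x))ᶜ :=
  ContDiff.dense_compl_range_of_finrank_lt_finrank (by fun_prop) (by simpa using hV)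

theorem exists_path_compl_range {r : ℝ → V} (hr : ContDiff ℝ 1 r) (hc : IsClosed (Set.range r))
    (hV : 2 < Module.finrank ℝ V) {W : Set V} (hW : IsOpen W) (hW' : Convex ℝ W)
    {x y : ((Set.range r)ᶜ : Set V)} (hx : (x : V) ∈ W) (hy : (y : V) ∈ W) :
    JoinedIn {z : ((Set.range r)ᶜ : Set V) | (z : V) ∈ W} x y := by
  have hU : (Set.range r)ᶜ ∩ W ∈ 𝓝 (y : V) :=
    (hc.isOpen_compl.inter hW).mem_nhds ⟨y.2, hy⟩
  obtain ⟨ε, hε, hball⟩ := Metric.mem_nhds_iff.1 hU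
  obtain ⟨z, hz, hzy⟩ := (dense_compl_cone hr hV (x : V)).exists_dist_lt (y : V) hε
  have hzb : z ∈ Metric.ball (y : V) ε := by rwa [Metric.mem_ball, dist_comm]
  have h2 : JoinedIn ((Set.range r)ᶜ ∩ W) z y :=
    JoinedIn.of_segment_subset (((convex_ball _ _).segment_subset hzb
      (Metric.mem_ball_self hε)).trans hball)
  have h1 : JoinedIn ((Set.range r)ᶜ ∩ W) (x : V) z := by
    refine JoinedIn.of_segment_subset fun w hw ↦
      ⟨?_, hW'.segment_subset hx (hball hzb).2 hw⟩
    rintro ⟨t, rfl⟩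
    rw [segment_eq_image'] at hw
    obtain ⟨θ, hθ, hw⟩ := hw
    simp only at hw
    rcases eq_or_ne θ 0 with rfl | h0
    · exact x.2 ⟨t, by simpa using hw.symm⟩
    · refine hz ⟨(θ⁻¹, t), ?_⟩
      simp [← hw, smul_smul, h0]
  obtain ⟨p, hp⟩ := h1.trans h2
  exact ⟨⟨⟨fun t ↦ ⟨p t, (hp t).1⟩, by fun_prop⟩, by simp, by simp⟩, fun t ↦ (hp t).2⟩

theorem dense_compl_range {r : ℝ → V} (hr : ContDiff ℝ 1 r) (hV : 2 < Module.finrank ℝ V) :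
    Dense (Set.range r)ᶜ :=
  hr.dense_compl_range_of_finrank_lt_finrank (by simp; omega)

end GeneralPosition

theorem Function.Periodic.exists_int_of_injOn {α : Type*} {r : ℝ → α} {T : ℝ} (hT : 0 < T)
    (hper : Function.Periodic r T) (hinj : Set.InjOn r (Set.Ico 0 T)) {s t : ℝ} (h : r s = r t) :
    ∃ k : ℤ, s = t + k * T := by
  refine ⟨toIcoDiv hT 0 s - toIcoDiv hT 0 t, ?_⟩
  have hs := self_sub_toIcoDiv_zsmul hT 0 s
  have ht := self_sub_toIcoDiv_zsmul hT 0 t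
  have e := hinj (by simpa using toIcoMod_mem_Ico hT 0 s) (by simpa using toIcoMod_mem_Ico hT 0 t)
    (by rw [← hs, ← ht, hper.sub_zsmul_eq, hper.sub_zsmul_eq, h])
  rw [← hs, ← ht] at e
  simp only [zsmul_eq_mul] at e
  push_cast
  linarith

theorem Function.Periodic.eq_of_abs_sub_lt {α : Type*} {r : ℝ → α} {T : ℝ} (hT : 0 < T)
    (hper : Function.Periodic r T) (hinj : Set.InjOn r (Set.Ico 0 T)) {s t : ℝ} (h : r s = r t)
    (hst : |s - t| < T) : s = t := by
  obtain ⟨k, hk⟩ := hper.exists_int_of_injOn hT hinj h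
  have : k = 0 := by
    have h1 : |(k : ℝ)| * T < 1 * T := by
      rw [hk, add_sub_cancel_left, abs_mul, abs_of_pos hT] at hst
      rwa [one_mul]
    have h2 : |(k : ℝ)| < 1 := lt_of_mul_lt_mul_right h1 hT.le
    exact Int.abs_lt_one_iff.1 (by exact_mod_cast h2)
  simp [hk, this]

theorem exists_tubular_chart {V : Type*} [NormedAddCommGroup V] [NormedSpace ℝ V]
    [FiniteDimensional ℝ V] (hV : Module.finrank ℝ V = 3) {r : ℝ → V}
    (hr : ContDiff ℝ 1 r) {T : ℝ} (hT : 0 < T) (hper : Function.Periodic r T)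
    (hinj : Set.InjOn r (Set.Ico 0 T)) (t₀ : ℝ) (hr' : deriv r t₀ ≠ 0) :
    ∃ (Φ : OpenPartialHomeomorph (ℝ × ℂ) V) (ε : ℝ), 0 < ε ∧
      Metric.ball (t₀, (0 : ℂ)) ε ⊆ Φ.source ∧ (∀ t, Φ (t, 0) = r t) ∧
      ∀ u ∈ Metric.ball (t₀, (0 : ℂ)) ε, u.2 ≠ 0 → Φ u ∉ Set.range r := by
  have : CompleteSpace V := FiniteDimensional.complete ℝ V
  obtain ⟨e, he⟩ : ∃ e : (ℝ × ℂ) ≃L[ℝ] V, e (1, 0) = deriv r t₀ := by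
    let e₀ : (ℝ × ℂ) ≃L[ℝ] V := ContinuousLinearEquiv.ofFinrankEq (by simp [hV])
    obtain ⟨A, hA⟩ := SeparatingDual.exists_continuousLinearEquiv_apply_eq (R := ℝ)
      (x := e₀ (1, 0)) (y := deriv r t₀) (by simp) hr'
    exact ⟨e₀.trans A, hA⟩
  let Ψ : ℝ × ℂ → V := fun u ↦ r u.1 + e (0, u.2)
  have hΨ : HasStrictFDerivAt Ψ (e : (ℝ × ℂ) →L[ℝ] V) (t₀, 0) := by
    have h1 : HasStrictDerivAt r (deriv r t₀) t₀ :=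
      hr.contDiffAt.hasStrictDerivAt (by simp)
    have h2 := HasStrictFDerivAt.comp (f := Prod.fst) (t₀, (0 : ℂ)) h1.hasStrictFDerivAt
      hasStrictFDerivAt_fst
    have h3 := ((e : (ℝ × ℂ) →L[ℝ] V).comp ((ContinuousLinearMap.inr ℝ ℝ ℂ).comp
      (ContinuousLinearMap.snd ℝ ℝ ℂ))).hasStrictFDerivAt (x := (t₀, (0 : ℂ)))
    refine (h2.add h3).congr_fderiv ?_
    ext1
    · ext
      simp [he]
    · ext; simp
  have hsrc : (hΨ.toOpenPartialHomeomorph Ψ).source ∈ 𝓝 (t₀, (0 : ℂ)) :=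
    (hΨ.toOpenPartialHomeomorph Ψ).open_source.mem_nhds hΨ.mem_toOpenPartialHomeomorph_source
  obtain ⟨ε₁, hε₁, hball⟩ := Metric.mem_nhds_iff.1 hsrc
  let K' : Set V := r '' (Set.Icc (t₀ - T / 2) (t₀ + T / 2) \ Metric.ball t₀ ε₁)
  have hK' : IsClosed K' :=
    ((isCompact_Icc.diff Metric.isOpen_ball).image hr.continuous).isClosed
  have hcΨ : Continuous Ψ := by
    have := hr.continuous
    fun_prop
  have hΨr : ∀ t, Ψ (t, 0) = r t := fun t ↦ by simp [Ψ]
  have hnot : Ψ (t₀, 0) ∉ K' := by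
    rw [hΨr]
    rintro ⟨s, ⟨hs, hs'⟩, h⟩
    have : s = t₀ := hper.eq_of_abs_sub_lt hT hinj h (by
      rw [abs_lt]; constructor <;> linarith [hs.1, hs.2])
    exact hs' (by simpa [this] using hε₁)
  obtain ⟨ε₂, hε₂, hball₂⟩ := Metric.mem_nhds_iff.1
    (hcΨ.continuousAt.preimage_mem_nhds (hK'.isOpen_compl.mem_nhds hnot))
  refine ⟨hΨ.toOpenPartialHomeomorph Ψ, min ε₁ ε₂, lt_min hε₁ hε₂,
    (Metric.ball_subset_ball (min_le_left _ _)).trans hball, hΨr, ?_⟩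
  rintro u hu hu2 ⟨s, hs⟩
  change r s = Ψ u at hs
  obtain ⟨s', hs', hss'⟩ : ∃ s' ∈ Set.Ico (t₀ - T / 2) (t₀ - T / 2 + T), r s = r s' :=
    hper.exists_mem_Ico hT s _
  rw [hss'] at hs
  by_cases hsε : s' ∈ Metric.ball t₀ ε₁
  · have : ((s', 0) : ℝ × ℂ) = u := by
      refine (hΨ.toOpenPartialHomeomorph Ψ).injOn (hball ?_)
        (hball (Metric.ball_subset_ball (min_le_left _ _) hu)) ((hΨr s').trans hs)
      simpa [Prod.dist_eq, hε₁] using hsε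
    exact hu2 (by rw [← this])
  · exact hball₂ (Metric.ball_subset_ball (min_le_right _ _) hu)
      ⟨s', ⟨⟨hs'.1, by linarith [hs'.2]⟩, hsε⟩, hs⟩

/-- Near a point of the curve, a cocycle on the complement has a well-defined value on meridians,
which generates its values on all loops. -/
theorem PathCocycle.exists_meridian_of_chart {V A : Type*} [NormedAddCommGroup V]
    [AddCommGroup A] {r : ℝ → V}
    (c : PathCocycle ((Set.range r)ᶜ : Set V) A) (t₀ : ℝ)
    (Φ : OpenPartialHomeomorph (ℝ × ℂ) V) {ε : ℝ} (hε : 0 < ε)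
    (hsrc : Metric.ball (t₀, (0 : ℂ)) ε ⊆ Φ.source) (hΦ : ∀ t, Φ (t, 0) = r t)
    (hΦ' : ∀ u ∈ Metric.ball (t₀, (0 : ℂ)) ε, u.2 ≠ 0 → Φ u ∉ Set.range r) :
    ∃ (W : Set V) (m : A), IsOpen W ∧ r t₀ ∈ W ∧
      (∀ (x : ((Set.range r)ᶜ : Set V)) (p : Path x x), (∀ s, (p s : V) ∈ W) →
        c.val p ∈ AddSubgroup.zmultiples m) ∧
      ∀ t ∈ Metric.ball t₀ ε, ∀ U : Set V, IsOpen U → r t ∈ U →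
        ∃ (x : ((Set.range r)ᶜ : Set V)) (p : Path x x), (∀ s, (p s : V) ∈ U) ∧ c.val p = m := by
  let E : Set (ℝ × ℂ) := Metric.ball t₀ ε ×ˢ {w | w.re < Real.log ε}
  have hE : Convex ℝ E := (convex_ball _ _).prod (convex_halfSpace_re_lt _)
  have hEmem : ∀ u : ℝ × ℂ, u ∈ E ↔ (u.1, Complex.exp u.2) ∈ Metric.ball (t₀, (0 : ℂ)) ε := by
    intro u
    simp [E, Prod.dist_eq, Complex.norm_exp, Real.lt_log_iff_exp_lt hε]
  have hEne : E.Nonempty := ⟨(t₀, ((Real.log ε - 1 : ℝ) : ℂ)), by simp [E, hε]⟩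
  have := hE.contractibleSpace hEne
  let f : C(E, ((Set.range r)ᶜ : Set V)) := ⟨fun u ↦ ⟨Φ (u.1.1, Complex.exp u.1.2),
    hΦ' _ ((hEmem u).1 u.2) (Complex.exp_ne_zero _)⟩, by
      refine Continuous.subtype_mk ?_ _
      exact Φ.continuousOn.comp_continuous (by fun_prop) fun u ↦ hsrc ((hEmem u).1 u.2)⟩
  obtain ⟨F, hF⟩ := c.exists_primitive f
  let τ : C(E, E) := ⟨fun u ↦ ⟨(u.1.1, u.1.2 + 2 * Real.pi * Complex.I), by
    have := u.2
    simp only [E, Set.mem_prod, Set.mem_ofPred_eq] at this ⊢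
    simpa using this⟩, by fun_prop⟩
  have hfτ : ∀ u, f (τ u) = f u := by
    intro u
    refine Subtype.ext ?_
    simp [f, τ, Complex.exp_add]
  have hτ : ∀ u u', F (τ u) - F u = F (τ u') - F u' := by
    intro u u'
    let q := PathConnectedSpace.somePath u u'
    have h1 := hF q
    have h2 := hF (q.map τ.continuous)
    have h3 : (q.map τ.continuous).map f.continuous =
        (q.map f.continuous).cast (hfτ u) (hfτ u') := by
      ext s
      exact congrArg Subtype.val (hfτ (q s))
    rw [h3, c.val_cast, h1] at h2
    rw [← sub_eq_zero, ← sub_eq_zero.2 h2]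
    abel
  let u₀ : E := ⟨_, hEne.choose_spec⟩
  have hm : ∀ u, F (τ u) = F u + (F (τ u₀) - F u₀) := fun u ↦ by rw [← hτ u u₀]; abel
  generalize F (τ u₀) - F u₀ = m at hm
  have hk : ∀ (k : ℤ) (u v : E), v.1 = (u.1.1, u.1.2 + k * (2 * Real.pi * Complex.I)) →
      F v = F u + k • m := by
    intro k u
    induction k using Int.induction_on with
    | zero => intro v hv; rw [show v = u from Subtype.ext (by simp [hv])]; simp
    | succ k ih =>
      intro v hv
      have hw : (u.1.1, u.1.2 + (k : ℤ) * (2 * Real.pi * Complex.I)) ∈ E := by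
        have := u.2
        simp only [E, Set.mem_prod, Set.mem_ofPred_eq] at this ⊢
        simpa using this
      have := ih ⟨_, hw⟩ rfl
      rw [show v = τ ⟨_, hw⟩ from Subtype.ext (by simp [hv, τ]; ring), hm, this, add_smul]
      simp [add_assoc]
    | pred k ih =>
      intro v hv
      have := ih (τ v) (by simp [hv, τ]; ring)
      rw [hm] at this
      rw [sub_smul, one_smul, ← add_sub_assoc, ← this, add_sub_cancel_right]
  refine ⟨Φ.target ∩ Φ.symm ⁻¹' Metric.ball (t₀, (0 : ℂ)) ε, m,
    Φ.isOpen_inter_preimage_symm Metric.isOpen_ball, ?_, ?_, ?_⟩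
  · have h0 : (t₀, (0 : ℂ)) ∈ Metric.ball (t₀, (0 : ℂ)) ε := Metric.mem_ball_self hε
    rw [← hΦ]
    exact ⟨Φ.map_source (hsrc h0), by rwa [Set.mem_preimage, Φ.left_inv (hsrc h0)]⟩
  · intro x p hp
    let g : C(I, ℝ × ℂ) := ⟨fun s ↦ Φ.symm (p s),
      Φ.symm.continuousOn.comp_continuous (by fun_prop) fun s ↦ (hp s).1⟩
    have hg : ∀ s, Φ (g s) = p s := fun s ↦ Φ.right_inv (hp s).1
    have hg0 : ∀ s, (g s).2 ≠ 0 := by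
      intro s h0
      refine (p s).2 ⟨(g s).1, ?_⟩
      rw [← hg s, ← hΦ, ← h0]
    obtain ⟨L, hL⟩ := exists_continuous_log ⟨fun s ↦ (g s).2, by fun_prop⟩ hg0
    simp only [ContinuousMap.coe_mk] at hL
    have hgE : ∀ s, ((g s).1, L s) ∈ E := fun s ↦ by
      rw [hEmem]
      simp only [hL]
      exact (hp s).2
    let q : Path (⟨_, hgE 0⟩ : E) ⟨_, hgE 1⟩ := ⟨⟨fun s ↦ ⟨_, hgE s⟩, by fun_prop⟩, rfl, rfl⟩
    have hfq : ∀ s, f (q s) = p s := by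
      intro s
      refine Subtype.ext ?_
      change Φ ((g s).1, Complex.exp (L s)) = p s
      rw [hL, ← hg]
    have h1 := hF q
    have h2 : q.map f.continuous = p.cast ((hfq 0).trans p.source) ((hfq 1).trans p.target) := by
      ext s
      exact congrArg Subtype.val (hfq s)
    rw [h2, c.val_cast] at h1
    have hg01 : g 1 = g 0 := by simp [g]
    have hL01 : Complex.exp (L 1) = Complex.exp (L 0) := by rw [hL, hL, hg01]
    obtain ⟨k, hkL⟩ := Complex.exp_eq_exp_iff_exists_int.1 hL01
    rw [h1, hk k ⟨_, hgE 0⟩ ⟨_, hgE 1⟩ (Prod.ext (show (g 1).1 = (g 0).1 by rw [hg01]) hkL), add_sub_cancel_left]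
    exact AddSubgroup.zsmul_mem_zmultiples m k
  · intro t ht U hU htU
    have htE : ((t, 0) : ℝ × ℂ) ∈ Metric.ball (t₀, (0 : ℂ)) ε := by
      simpa [Prod.dist_eq, hε] using ht
    have hc : ContinuousAt (fun z : ℂ ↦ Φ (t, z)) 0 :=
      ContinuousAt.comp (f := fun z : ℂ ↦ (t, z)) (Φ.continuousAt (hsrc htE)) (by fun_prop)
    obtain ⟨η, hη, hball⟩ := Metric.mem_nhds_iff.1
      (hc.preimage_mem_nhds (hU.mem_nhds (by rwa [hΦ])))
    let w : ℝ := Real.log (min η ε / 2)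
    have hpos : 0 < min η ε := lt_min hη hε
    have hw : Real.exp w < min η ε := by
      rw [Real.exp_log (by positivity)]; linarith
    have hqE : ∀ s : I, (t, (w : ℂ) + (s : ℝ) * (2 * Real.pi * Complex.I)) ∈ E := by
      intro s
      refine ⟨ht, ?_⟩
      have : w < Real.log ε := (Real.lt_log_iff_exp_lt hε).2 (hw.trans_le (min_le_right _ _))
      simpa using this
    let q : Path (⟨_, hqE 0⟩ : E) ⟨_, hqE 1⟩ := ⟨⟨fun s ↦ ⟨_, hqE s⟩, by fun_prop⟩, rfl, rfl⟩
    have hq01 : f ⟨_, hqE 0⟩ = f ⟨_, hqE 1⟩ := by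
      refine Subtype.ext ?_
      simp [f, Complex.exp_add]
    refine ⟨_, (q.map f.continuous).cast rfl hq01, fun s ↦ ?_, ?_⟩
    · refine hball (show Complex.exp ((w : ℂ) + (s : ℝ) * (2 * Real.pi * Complex.I)) ∈ _ from ?_)
      rw [mem_ball_zero_iff, Complex.norm_exp]
      simpa using hw.trans_le (min_le_left _ _)
    · rw [c.val_cast, hF, hk 1 ⟨_, hqE 0⟩ ⟨_, hqE 1⟩ (by simp)]
      simp

theorem PathCocycle.exists_zmultiples {V A : Type*} [NormedAddCommGroup V] [NormedSpace ℝ V]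
    [FiniteDimensional ℝ V] [AddCommGroup A] (hV : Module.finrank ℝ V = 3) {r : ℝ → V}
    (hr : ContDiff ℝ 1 r) {T : ℝ} (hT : 0 < T) (hper : Function.Periodic r T)
    (hinj : Set.InjOn r (Set.Ico 0 T)) (hr' : ∀ t, deriv r t ≠ 0)
    (c : PathCocycle ((Set.range r)ᶜ : Set V) A) :
    ∃ m : A, ∀ (x : ((Set.range r)ᶜ : Set V)) (p : Path x x),
      c.val p ∈ AddSubgroup.zmultiples m := by
  have hchart : ∀ t₀ : ℝ, ∃ (ε : ℝ) (W : Set V) (m : A), 0 < ε ∧ IsOpen W ∧ r t₀ ∈ W ∧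
      (∀ (x : ((Set.range r)ᶜ : Set V)) (p : Path x x), (∀ s, (p s : V) ∈ W) →
        c.val p ∈ AddSubgroup.zmultiples m) ∧
      ∀ t ∈ Metric.ball t₀ ε, ∀ U : Set V, IsOpen U → r t ∈ U →
        ∃ (x : ((Set.range r)ᶜ : Set V)) (p : Path x x), (∀ s, (p s : V) ∈ U) ∧ c.val p = m := by
    intro t₀
    obtain ⟨Φ, ε, hε, h1, h2, h3⟩ := exists_tubular_chart hV hr hT hper hinj t₀ (hr' t₀)
    obtain ⟨W, m, h⟩ := c.exists_meridian_of_chart t₀ Φ hε h1 h2 h3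
    exact ⟨ε, W, m, hε, h⟩
  choose ε W m hε hW hrW hloop hmer using hchart
  have hloc : IsLocallyConstant fun t ↦ AddSubgroup.zmultiples (m t) := by
    rw [IsLocallyConstant.iff_eventually_eq]
    intro t₀
    filter_upwards [Metric.ball_mem_nhds t₀ (hε t₀),
      hr.continuous.continuousAt.preimage_mem_nhds ((hW t₀).mem_nhds (hrW t₀))] with t ht htW
    apply le_antisymm <;> rw [AddSubgroup.zmultiples_le]
    · obtain ⟨x, p, hp, hpm⟩ := hmer t t (Metric.mem_ball_self (hε t)) (W t₀) (hW t₀) htW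
      exact hpm ▸ hloop t₀ x p hp
    · obtain ⟨x, p, hp, hpm⟩ := hmer t₀ t ht (W t) (hW t) (hrW t)
      exact hpm ▸ hloop t x p hp
  have hclosed : IsClosed (Set.range r) :=
    (hper.compact_of_continuous hT.ne' hr.continuous).isClosed
  refine ⟨m 0, fun x p ↦ ?_⟩
  suffices (c.map (QuotientAddGroup.mk' (AddSubgroup.zmultiples (m 0)))).val p = 0 from
    (QuotientAddGroup.eq_zero_iff _).1 this
  refine PathCocycle.eq_zero_of_locally (dense_compl_range hr (by omega))
    (fun v δ x y hx hy ↦ exists_path_compl_range hr hclosed (by omega) Metric.isOpen_ball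
      (convex_ball v δ) hx hy) _ (fun v ↦ ?_) x p
  by_cases hv : v ∈ Set.range r
  · obtain ⟨t, rfl⟩ := hv
    obtain ⟨δ, hδ, hball⟩ := Metric.isOpen_iff.1 (hW t) _ (hrW t)
    refine ⟨δ, hδ, fun x p hp ↦ (QuotientAddGroup.eq_zero_iff _).2 ?_⟩
    rw [show AddSubgroup.zmultiples (m 0) = AddSubgroup.zmultiples (m t) from
      hloc.apply_eq_of_preconnectedSpace 0 t]
    exact hloop t x p fun s ↦ hball (hp s)
  · obtain ⟨δ, hδ, hball⟩ := Metric.isOpen_iff.1 hclosed.isOpen_compl _ hv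
    refine ⟨δ, hδ, fun x p hp ↦ ?_⟩
    have := (convex_ball v δ).contractibleSpace ⟨v, Metric.mem_ball_self hδ⟩
    let f : C(Metric.ball v δ, ((Set.range r)ᶜ : Set V)) :=
      ⟨fun y ↦ ⟨y, hball y.2⟩, by fun_prop⟩
    obtain ⟨F, hF⟩ := (c.map (QuotientAddGroup.mk' (AddSubgroup.zmultiples (m 0)))).exists_primitive f
    let q : Path (⟨x, by simpa using hp 0⟩ : Metric.ball v δ) ⟨x, by simpa using hp 0⟩ :=
      ⟨⟨fun s ↦ ⟨p s, hp s⟩, by fun_prop⟩, by simp, by simp⟩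
    have := hF q
    rwa [sub_self] at this

/-- The vertices of a regular polygon with `n + 1` vertices inscribed in a curve of period `T`,
placed symmetrically around the parameter `0`. -/
noncomputable def inscribedPolygon {α : Type*} (R : ℝ → α) (T : ℝ) (n i : ℕ) : α :=
  R ((2 * i + 1) * (T / (2 * (n + 1))))

theorem inscribedPolygon_zero {α : Type*} (R : ℝ → α) (T : ℝ) (n : ℕ) :
    inscribedPolygon R T n 0 = R (T / (2 * (n + 1))) := by
  simp [inscribedPolygon]

theorem inscribedPolygon_self {α : Type*} {R : ℝ → α} {T : ℝ} (h : Function.Periodic R T) (n : ℕ) :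
    inscribedPolygon R T n n = R (-(T / (2 * (n + 1)))) := by
  rw [inscribedPolygon, ← h (-(T / _))]
  congr 1
  field_simp
  ring

theorem dist_left_le_of_mem_segment {V : Type*} [SeminormedAddCommGroup V] [NormedSpace ℝ V]
    {x a b : V} (h : x ∈ segment ℝ a b) : dist x a ≤ dist b a :=
  (convex_closedBall a (dist b a)).segment_subset (Metric.mem_closedBall_self dist_nonneg)
    (Metric.mem_closedBall.2 le_rfl) h

theorem eventually_inscribedPolygon_step_lt (T : ℝ) {η : ℝ} (hη : 0 < η) :
    ∀ᶠ n : ℕ in atTop, 2 * (T / (2 * (n + 1))) < η := by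
  have h : Tendsto (fun n : ℕ ↦ T * (1 / ((n : ℝ) + 1))) atTop (𝓝 (T * 0)) :=
    tendsto_one_div_add_atTop_nhds_zero_nat.const_mul T
  rw [mul_zero] at h
  filter_upwards [h.eventually (gt_mem_nhds hη)] with n hn
  rwa [show 2 * (T / (2 * ((n : ℝ) + 1))) = T * (1 / ((n : ℝ) + 1)) by field_simp]

theorem eventually_dist_inscribedPolygon_lt {α : Type*} [PseudoMetricSpace α] {R : ℝ → α}
    (hR : Continuous R) {T : ℝ} (hT : 0 < T) (hper : Function.Periodic R T) {ε : ℝ} (hε : 0 < ε) :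
    ∀ᶠ n : ℕ in atTop, (∀ i < n, dist (inscribedPolygon R T n (i + 1))
      (inscribedPolygon R T n i) < ε) ∧
      dist (inscribedPolygon R T n 0) (inscribedPolygon R T n n) < ε ∧
      dist (inscribedPolygon R T n 0) (R 0) < ε ∧ dist (inscribedPolygon R T n n) (R 0) < ε := by
  have hu := (isCompact_Icc (a := -T) (b := T)).uniformContinuousOn_of_continuous hR.continuousOn
  obtain ⟨η, hη, h⟩ := Metric.uniformContinuousOn_iff.1 hu ε hε
  filter_upwards [eventually_inscribedPolygon_step_lt T hη] with n hn
  have hpos : 0 < T / (2 * ((n : ℝ) + 1)) := by positivity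
  have hT' : 2 * ((n : ℝ) + 1) * (T / (2 * (n + 1))) = T := by field_simp
  rw [inscribedPolygon_zero, inscribedPolygon_self hper]
  simp only [inscribedPolygon]
  generalize T / (2 * ((n : ℝ) + 1)) = a at *
  have hn0 : (0 : ℝ) ≤ n := n.cast_nonneg
  have haT : a ≤ T := by nlinarith
  refine ⟨fun i hi ↦ ?_, ?_, ?_, ?_⟩
  · have hi1 : (i : ℝ) + 1 ≤ n := by exact_mod_cast hi
    have hi0 : (0 : ℝ) ≤ i := i.cast_nonneg
    refine h _ ⟨?_, ?_⟩ _ ⟨?_, ?_⟩ ?_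
    · push_cast; nlinarith
    · push_cast; nlinarith
    · nlinarith
    · nlinarith
    · rw [Real.dist_eq, abs_of_nonneg] <;> push_cast <;> nlinarith
  all_goals
    refine h _ ⟨by linarith, by linarith⟩ _ ⟨by linarith, by linarith⟩ ?_
    rw [Real.dist_eq, abs_lt]
    constructor <;> linarith

theorem eventually_polygonFun_ne_zero {R : ℝ → EuclideanSpace ℝ (Fin 3)} (hR : Continuous R)
    {T : ℝ} (hT : 0 < T) (hper : Function.Periodic R T) {C : Set (EuclideanSpace ℝ (Fin 3))}
    (hC : IsCompact C) (hCR : Disjoint C (Set.range R)) :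
    ∀ᶠ n in atTop, ∀ x ∈ C, polygonFun (inscribedPolygon R T n) n x ≠ 0 := by
  obtain ⟨ε, hε, hd⟩ := hCR.exists_thickenings hC
    (hper.compact_of_continuous hT.ne' hR).isClosed
  filter_upwards [eventually_dist_inscribedPolygon_lt hR hT hper hε] with n ⟨h1, h2, _, _⟩ x hx
  have key : ∀ s b, dist b (R s) < ε → x ∉ segment ℝ (R s) b := by
    intro s b hb hxs
    refine Set.disjoint_left.1 hd (Metric.self_subset_thickening hε C hx) ?_
    exact Metric.mem_thickening_iff.2 ⟨R s, ⟨s, rfl⟩, (dist_left_le_of_mem_segment hxs).trans_lt hb⟩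
  exact polygonFun_ne_zero (fun i hi ↦ key _ _ (h1 i hi)) (key _ _ h2)

theorem norm_horizontal {ρ : ℝ} (hρ : 0 ≤ ρ) (z : ℂ) : ‖horizontal ρ z‖ = ρ * ‖z‖ := by
  rw [← sq_eq_sq₀ (norm_nonneg _) (by positivity), EuclideanSpace.real_norm_sq_eq,
    Fin.sum_univ_three, mul_pow, Complex.sq_norm, Complex.normSq_apply]
  simp [horizontal]
  ring

theorem norm_add_mul_I_le_norm (v : EuclideanSpace ℝ (Fin 3)) :
    ‖(v 0 + v 1 * Complex.I : ℂ)‖ ≤ ‖v‖ := by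
  rw [← sq_le_sq₀ (norm_nonneg _) (norm_nonneg _), EuclideanSpace.real_norm_sq_eq,
    Fin.sum_univ_three, Complex.sq_norm, Complex.normSq_add_mul_I]
  linarith [sq_nonneg (v 2)]

theorem apply_eq_zero_of_segment {x a b : EuclideanSpace ℝ (Fin 3)} (h : x ∈ segment ℝ a b)
    (hx : x 2 = 0) : ¬ (0 < a 2 ∧ 0 < b 2) ∧ ¬ (a 2 < 0 ∧ b 2 < 0) := by
  obtain ⟨α, β, hα, hβ, hαβ, rfl⟩ := h
  simp only [PiLp.add_apply, PiLp.smul_apply, smul_eq_mul] at hx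
  rcases hα.eq_or_lt with rfl | hα
  · obtain rfl : β = 1 := by linarith
    constructor <;> rintro ⟨h1, h2⟩ <;> linarith
  · constructor <;> rintro ⟨h1, h2⟩
    · nlinarith [mul_pos hα h1]
    · nlinarith [mul_neg_of_pos_of_neg hα h1]

theorem exists_horizontal_circle {R : ℝ → EuclideanSpace ℝ (Fin 3)} (hR : Continuous R)
    {T : ℝ} (hT : 0 < T) (hper : Function.Periodic R T) (hinj : Set.InjOn R (Set.Ico 0 T))
    (hR0 : R 0 = 0) (hR' : 0 < deriv (fun t ↦ R t 2) 0) :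
    ∃ ρ : ℝ, (∀ z : ℂ, ‖z‖ = 1 → horizontal ρ z ∉ Set.range R) ∧
      ∀ᶠ n in atTop, logVariation (fun s : I ↦ polygonFun (inscribedPolygon R T n) n
        (horizontal ρ (Complex.exp (2 * Real.pi * Complex.I * (s : ℝ))))) =
        2 * Real.pi * Complex.I := by
  obtain ⟨δ, hδ, hsign⟩ := Metric.eventually_nhds_iff.1
    (eventually_nhdsWithin_sign_eq_of_deriv_pos hR' (by simp [hR0]))
  simp only [sub_zero, dist_zero_right, Real.norm_eq_abs] at hsign
  have hpos : ∀ t, 0 < t → t < δ → 0 < R t 2 := fun t h0 h1 ↦ by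
    rw [← sign_eq_one_iff, hsign (by rwa [abs_of_pos h0]), sign_eq_one_iff]
    exact h0
  have hneg : ∀ t, t < T → T - t < δ → R t 2 < 0 := fun t h0 h1 ↦ by
    rw [← sub_add_cancel t T, hper, ← sign_eq_neg_one_iff,
      hsign (by rw [abs_lt]; constructor <;> linarith), sign_eq_neg_one_iff]
    linarith
  have hfar : IsCompact (R '' Set.Icc (δ / 2) (T - δ / 2)) := isCompact_Icc.image hR
  have h0far : (0 : EuclideanSpace ℝ (Fin 3)) ∉ R '' Set.Icc (δ / 2) (T - δ / 2) := by
    rintro ⟨t, ht, ht0⟩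
    have := hper.eq_of_abs_sub_lt hT hinj (ht0.trans hR0.symm)
      (by rw [abs_lt]; constructor <;> linarith [ht.1, ht.2])
    linarith [ht.1]
  obtain ⟨ε, hε, hball⟩ := Metric.isOpen_iff.1 hfar.isClosed.isOpen_compl 0 h0far
  have hfar : ∀ t, δ / 2 ≤ t → t ≤ T - δ / 2 → ε ≤ ‖R t‖ := by
    intro t h1 h2
    by_contra! h
    exact hball (mem_ball_zero_iff.2 h) ⟨t, ⟨h1, h2⟩, rfl⟩
  have hρ : 0 < ε / 2 := half_pos hε
  have hz2 : ∀ z, horizontal (ε / 2) z 2 = 0 := fun z ↦ by simp [horizontal]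
  refine ⟨ε / 2, ?_, ?_⟩
  · rintro z hz ⟨t, ht⟩
    obtain ⟨s, hs, hts⟩ := hper.exists_mem_Ico₀ hT t
    rw [hts] at ht
    have hn : ‖R s‖ = ε / 2 := by rw [ht, norm_horizontal hρ.le, hz, mul_one]
    have h2 : R s 2 = 0 := by rw [ht, hz2]
    rcases hs.1.eq_or_lt with h0 | h0
    · rw [← h0, hR0, norm_zero] at hn
      exact hρ.ne hn
    · rcases lt_or_ge s (δ / 2) with h3 | h3
      · exact (hpos s h0 (by linarith)).ne' h2
      · rcases lt_or_ge (T - δ / 2) s with h4 | h4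
        · exact (hneg s hs.2 (by linarith)).ne h2
        · linarith [hfar s h3 h4]
  · filter_upwards [eventually_dist_inscribedPolygon_lt hR hT hper hρ,
      eventually_inscribedPolygon_step_lt T (half_pos hδ)] with n ⟨h1, _, h3, h4⟩ hn
    rw [hR0, dist_zero_right] at h3 h4
    have hpos' : 0 < T / (2 * ((n : ℝ) + 1)) := by positivity
    have hT' : 2 * ((n : ℝ) + 1) * (T / (2 * (n + 1))) = T := by field_simp
    refine logVariation_polygonFun (fun z hz i hi hseg ↦ ?_) ?_ ?_
      ((norm_add_mul_I_le_norm _).trans_lt h3) ((norm_add_mul_I_le_norm _).trans_lt h4)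
    · obtain ⟨hs1, hs2⟩ := apply_eq_zero_of_segment hseg (hz2 z)
      have hd := (dist_left_le_of_mem_segment hseg).trans_lt (h1 i hi)
      have hzn : ‖horizontal (ε / 2) z‖ ≤ ε / 2 := by
        rw [norm_horizontal hρ.le]; nlinarith
      have hi1 : (i : ℝ) + 1 ≤ n := by exact_mod_cast hi
      have hi0 : (0 : ℝ) ≤ i := i.cast_nonneg
      simp only [inscribedPolygon] at hs1 hs2 hd
      push_cast at hs1 hs2
      generalize T / (2 * ((n : ℝ) + 1)) = a at *
      rcases lt_or_ge ((2 * (i + 1) + 1) * a) δ with h5 | h5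
      · exact hs1 ⟨hpos _ (by positivity) (by linarith), hpos _ (by positivity) h5⟩
      · rcases lt_or_ge (T - δ / 2) ((2 * i + 1) * a) with h6 | h6
        · exact hs2 ⟨hneg _ (by nlinarith) (by linarith), hneg _ (by nlinarith) (by linarith)⟩
        · have := hfar ((2 * i + 1) * a) (by linarith) h6
          have := norm_sub_norm_le (R ((2 * i + 1) * a)) (horizontal (ε / 2) z)
          rw [dist_comm, dist_eq_norm] at hd
          linarith
    · rw [inscribedPolygon_zero]
      exact hpos _ hpos' (by linarith)
    · rw [inscribedPolygon_self hper, ← hper]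
      exact hneg _ (by linarith) (by linarith)

theorem exists_cocycle_loop {r : ℝ → EuclideanSpace ℝ (Fin 3)} (hr : ContDiff ℝ 1 r)
    {T : ℝ} (hT : 0 < T) (hper : Function.Periodic r T) (hinj : Set.InjOn r (Set.Ico 0 T))
    (hr' : deriv r 0 ≠ 0) :
    ∃ (c : PathCocycle ((Set.range r)ᶜ : Set (EuclideanSpace ℝ (Fin 3))) (Germ (atTop : Filter ℕ) ℂ))
      (x : ((Set.range r)ᶜ : Set (EuclideanSpace ℝ (Fin 3)))) (p : Path x x),
      c.val p = ((2 * Real.pi * Complex.I : ℂ) : Germ (atTop : Filter ℕ) ℂ) := by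
  obtain ⟨A, hA⟩ := SeparatingDual.exists_continuousLinearEquiv_apply_eq (R := ℝ)
    (x := deriv r 0) (y := EuclideanSpace.single (2 : Fin 3) (1 : ℝ)) hr' (by simp)
  let φ : EuclideanSpace ℝ (Fin 3) → EuclideanSpace ℝ (Fin 3) := fun x ↦ A (x - r 0)
  have hφ : Continuous φ := by fun_prop
  have hφi : Function.Injective φ := fun x y h ↦ by simpa [φ] using h
  let R : ℝ → EuclideanSpace ℝ (Fin 3) := φ ∘ r
  have hR : Continuous R := hφ.comp hr.continuous
  have hRper : Function.Periodic R T := hper.comp φ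
  have hRd : HasDerivAt (fun t ↦ R t 2) 1 0 := by
    have h1 : HasDerivAt r (deriv r 0) 0 :=
      (hr.differentiable (by simp)).differentiableAt.hasDerivAt
    have h2 := ((EuclideanSpace.proj (𝕜 := ℝ) (2 : Fin 3)).comp
      (A : EuclideanSpace ℝ (Fin 3) →L[ℝ] EuclideanSpace ℝ (Fin 3))).hasFDerivAt.comp_hasDerivAt
      (0 : ℝ) (h1.sub_const (r 0))
    refine HasDerivAt.congr_deriv (f := fun t ↦ R t 2) h2 ?_
    simp [hA]
  obtain ⟨ρ, hρ, hvar⟩ := exists_horizontal_circle hR hT hRper (hφi.comp_injOn hinj) (by simp [R, φ])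
    (by rw [hRd.deriv]; exact one_pos)
  let c := PathCocycle.ofNonvanishing (X := ((Set.range r)ᶜ : Set (EuclideanSpace ℝ (Fin 3))))
    (fun n x ↦ polygonFun (inscribedPolygon R T n) n (φ x))
    (fun n ↦ (continuous_polygonFun _ _).comp (hφ.comp continuous_subtype_val)) (by
      intro C hC
      have hC' : IsCompact ((fun x : ((Set.range r)ᶜ : Set _) ↦ φ x) '' C) := hC.image (hφ.comp continuous_subtype_val)
      filter_upwards [eventually_polygonFun_ne_zero hR hT hRper hC' (by
        rw [Set.disjoint_left]
        rintro _ ⟨x, -, rfl⟩ ⟨t, ht⟩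
        exact x.2 ⟨t, hφi ht⟩)] with n hn x hx
      exact hn _ ⟨x, hx, rfl⟩)
  let g : I → EuclideanSpace ℝ (Fin 3) := fun s ↦
    A.symm (horizontal ρ (Complex.exp (2 * Real.pi * Complex.I * (s : ℝ)))) + r 0
  have hg : Continuous g := by
    have := continuous_horizontal ρ
    fun_prop
  have hφg : ∀ s, φ (g s) = horizontal ρ (Complex.exp (2 * Real.pi * Complex.I * (s : ℝ))) := by
    intro s; simp [φ, g]
  have hgr : ∀ s, g s ∉ Set.range r := by
    rintro s ⟨t, ht⟩
    refine hρ (Complex.exp (2 * Real.pi * Complex.I * (s : ℝ))) ?_ ⟨t, ?_⟩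
    · rw [show (2 * Real.pi * Complex.I * (s : ℝ) : ℂ) = ((2 * Real.pi * s : ℝ) : ℂ) * Complex.I by
        push_cast; ring]
      exact Complex.norm_exp_ofReal_mul_I _
    · rw [← hφg, ← ht]; rfl
  refine ⟨c, ⟨g 0, hgr 0⟩, ⟨⟨fun s ↦ ⟨g s, hgr s⟩, by fun_prop⟩, rfl, ?_⟩, ?_⟩
  · simp [g]
  · refine Germ.coe_eq.2 ?_
    filter_upwards [hvar] with n hn
    exact (congrArg logVariation (funext fun s ↦ congrArg _ (hφg s))).trans hn

theorem infinite_abelianization_of_cocycle {X : Type*} [TopologicalSpace X] [PathConnectedSpace X]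
    {A : Type*} [AddCommGroup A] (c : PathCocycle X A) {x : X} (p : Path x x)
    (hp : ∀ k : ℕ, 0 < k → k • c.val p ≠ 0) (x₀ : X) :
    Infinite (Abelianization (FundamentalGroup X x₀)) := by
  by_contra hfin
  rw [not_infinite_iff_finite] at hfin
  let q := PathConnectedSpace.somePath x₀ x
  obtain ⟨k, hk, hpow⟩ := (isOfFinOrder_of_finite (Abelianization.of (FundamentalGroup.fromPath
    (Path.Homotopic.Quotient.mk ((q.trans p).trans q.symm))))).exists_pow_eq_one
  refine hp k hk ?_
  have := congrArg (Abelianization.lift (c.hom x₀)) hpow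
  rw [map_pow, Abelianization.lift_apply_of, c.hom_mk, map_one, ← ofAdd_nsmul, c.trans, c.trans,
    c.symm, add_neg_cancel_comm] at this
  exact this

theorem exists_zpowers_abelianization_eq_top {X : Type*} [TopologicalSpace X]
    [PathConnectedSpace X] (x₀ : X)
    (h : ∀ c : PathCocycle X (Additive (Abelianization (FundamentalGroup X x₀))),
      ∃ m, ∀ p : Path x₀ x₀, c.val p ∈ AddSubgroup.zmultiples m) :
    ∃ g : Abelianization (FundamentalGroup X x₀), Subgroup.zpowers g = ⊤ := by
  obtain ⟨c, hc⟩ := PathCocycle.exists_universal x₀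
  obtain ⟨m, hm⟩ := h c
  refine ⟨m.toMul, Subgroup.eq_top_iff' _ |>.2 fun a ↦ ?_⟩
  obtain ⟨g, rfl⟩ := QuotientGroup.mk_surjective a
  induction g using Path.Homotopic.Quotient.ind with | mk p =>
  obtain ⟨k, hk⟩ := hm p
  rw [hc] at hk
  exact ⟨k, hk⟩

end

/-- The first homology of a knot complement is infinite cyclic: the
abelianized fundamental group of the complement is isomorphic to `ℤ`. -/
theorem knot_complement_first_homology
    (r : ℝ → EuclideanSpace ℝ (Fin 3))
    (hr : ContDiff ℝ (⊤ : ℕ∞) r)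
    (hper : Function.Periodic r (2 * Real.pi))
    (hinj : Set.InjOn r (Set.Ico 0 (2 * Real.pi)))
    (hr' : ∀ t, deriv r t ≠ 0)
    (K : Set (EuclideanSpace ℝ (Fin 3))) (hK : K = Set.range r)
    (x₀ : ((Set.univ : Set (EuclideanSpace ℝ (Fin 3))) \ K : Set (EuclideanSpace ℝ (Fin 3)))) :
    Nonempty
      (Abelianization (FundamentalGroup
          ((Set.univ : Set (EuclideanSpace ℝ (Fin 3))) \ K : Set (EuclideanSpace ℝ (Fin 3))) x₀)
        ≃* Multiplicative ℤ) := by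
  have hX : (Set.univ \ K : Set (EuclideanSpace ℝ (Fin 3))) = (Set.range r)ᶜ := by
    rw [hK, Set.compl_eq_univ_sdiff]
  generalize Set.univ \ K = X at x₀ hX
  subst hX
  have hr1 : ContDiff ℝ 1 r := hr.of_le (by exact_mod_cast le_top)
  have hT : 0 < 2 * Real.pi := Real.two_pi_pos
  have hdim : Module.finrank ℝ (EuclideanSpace ℝ (Fin 3)) = 3 := by simp
  have hclosed : IsClosed (Set.range r) :=
    (hper.compact_of_continuous hT.ne' hr.continuous).isClosed
  have : PathConnectedSpace ((Set.range r)ᶜ : Set (EuclideanSpace ℝ (Fin 3))) :=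
    ⟨⟨x₀⟩, fun x y ↦ (exists_path_compl_range hr1 hclosed (by omega) isOpen_univ convex_univ
      (Set.mem_univ _) (Set.mem_univ _)).joined⟩
  obtain ⟨g, hg⟩ := exists_zpowers_abelianization_eq_top x₀ fun c ↦ by
    obtain ⟨m, hm⟩ := c.exists_zmultiples hdim hr1 hT hper hinj hr'
    exact ⟨m, hm x₀⟩
  obtain ⟨c, x, p, hp⟩ := exists_cocycle_loop hr1 hT hper hinj (hr' 0)
  have := infinite_abelianization_of_cocycle c p (fun k hk h ↦ by
    rw [hp] at h
    have h' : ((k • (2 * Real.pi * Complex.I : ℂ) : ℂ) : Filter.Germ (Filter.atTop : Filter ℕ) ℂ) =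
      ((0 : ℂ) : Filter.Germ (Filter.atTop : Filter ℕ) ℂ) := h
    rw [Filter.Germ.const_inj, smul_eq_zero] at h'
    exact h'.elim hk.ne' Complex.two_pi_I_ne_zero) x₀
  exact ⟨(intEquivOfZPowersEqTop g hg).symm⟩
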